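/- Let ζ: ℝ^D → ℝ be 1-Lipschitz with respect to the Euclidean norm, S ∈ ℝ^D a vector with i.i.d. standard Gaussian entries, and for ε > 0 define the regularization ζ_ε(u) := E[ζ(u + εS)]. Then ζ_ε is infinitely differentiable and for all u and all indices i, j, k: |∂_i ζ_ε(u)| ≤ 1, |∂_{i,j} ζ_ε(u)| ≤ 1/ε, and |∂_{i,j,k} ζ_ε(u)| ≤ 1/ε². -/

import Mathlib

open MeasureTheory ProbabilityTheory Finset

noncomputable section

/-- `ζ` is `1`-Lipschitz with respect to the Euclidean norm on `ι → ℝ`. -/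
def LipschitzEuclid {ι : Type*} [Fintype ι] (ζ : (ι → ℝ) → ℝ) : Prop :=
  ∀ f g : ι → ℝ, |ζ f - ζ g| ≤ Real.sqrt (∑ i, (f i - g i) ^ 2)

/-- The Wasserstein-1 distance between the laws of `X` and `Y`, as a supremum over
`1`-Lipschitz (w.r.t. the Euclidean norm) test functions. -/
def d1 {Ω : Type*} [MeasurableSpace Ω] {ι : Type*} [Fintype ι]
    (μ : Measure Ω) (X Y : Ω → ι → ℝ) : ℝ :=
  sSup {r | ∃ ζ : (ι → ℝ) → ℝ, LipschitzEuclid ζ ∧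
    r = |(∫ ω, ζ (X ω) ∂μ) - ∫ ω, ζ (Y ω) ∂μ|}

/-- First partial derivative of `η` at `x` in coordinate `i`. -/
def pd1 {ι : Type*} [Fintype ι] [DecidableEq ι] (η : (ι → ℝ) → ℝ) (x : ι → ℝ) (i : ι) : ℝ :=
  iteratedFDeriv ℝ 1 η x fun _ => Pi.single i 1

/-- Second partial derivative of `η` at `x` in coordinates `i, j`. -/
def pd2 {ι : Type*} [Fintype ι] [DecidableEq ι] (η : (ι → ℝ) → ℝ) (x : ι → ℝ) (i j : ι) : ℝ :=
  iteratedFDeriv ℝ 2 η x ![Pi.single i 1, Pi.single j 1]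

/-- Third partial derivative of `η` at `x` in coordinates `i, j, k`. -/
def pd3 {ι : Type*} [Fintype ι] [DecidableEq ι] (η : (ι → ℝ) → ℝ) (x : ι → ℝ) (i j k : ι) : ℝ :=
  iteratedFDeriv ℝ 3 η x ![Pi.single i 1, Pi.single j 1, Pi.single k 1]

/-- Test functions for the `d₃` metric: three times differentiable with all first, second and
third partial derivatives bounded by one. -/
def TestD3 {ι : Type*} [Fintype ι] [DecidableEq ι] (ζ : (ι → ℝ) → ℝ) : Prop :=
  ContDiff ℝ 3 ζ ∧ (∀ x i, |pd1 ζ x i| ≤ 1) ∧ (∀ x i j, |pd2 ζ x i j| ≤ 1) ∧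
    (∀ x i j k, |pd3 ζ x i j k| ≤ 1)

/-- The `d₃` integral probability metric between the laws of `X` and `Y`. -/
def d3 {Ω : Type*} [MeasurableSpace Ω] {ι : Type*} [Fintype ι] [DecidableEq ι]
    (μ : Measure Ω) (X Y : Ω → ι → ℝ) : ℝ :=
  sSup {r | ∃ ζ : (ι → ℝ) → ℝ, TestD3 ζ ∧
    r = |(∫ ω, ζ (X ω) ∂μ) - ∫ ω, ζ (Y ω) ∂μ|}


section GaussianSmoothing

open Real

variable {ι : Type*} [Fintype ι]

/-- The standard Gaussian measure on `ι → ℝ`. -/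
abbrev stdGaussianPi (ι : Type*) [Fintype ι] : Measure (ι → ℝ) :=
  Measure.pi fun _ : ι => gaussianReal 0 1

lemma gaussianReal_eq_withDensity_exp (m : ℝ) :
    gaussianReal m 1 =
      (gaussianReal 0 1).withDensity fun x => ENNReal.ofReal (exp (m * x - m ^ 2 / 2)) := by
  rw [gaussianReal_of_var_ne_zero m one_ne_zero, gaussianReal_of_var_ne_zero 0 one_ne_zero,
    ← withDensity_mul _ (measurable_gaussianPDF 0 1) (by fun_prop)]
  congr 1
  ext x
  simp only [Pi.mul_apply, gaussianPDF, gaussianPDFReal]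
  rw [← ENNReal.ofReal_mul (by positivity), mul_assoc (_)⁻¹, ← exp_add]
  congr 3
  push_cast
  ring

lemma integrable_exp_tilt (m : ℝ) :
    Integrable (fun x => exp (m * x - m ^ 2 / 2)) (gaussianReal 0 1) := by
  simp_rw [sub_eq_add_neg, exp_add]
  exact (integrable_exp_mul_gaussianReal m).mul_const _

lemma stdGaussianPi_map_add (x : ι → ℝ) :
    (stdGaussianPi ι).map (fun v i => v i + x i) =
      (stdGaussianPi ι).withDensity
        fun v => ENNReal.ofReal (exp (∑ i, (x i * v i - x i ^ 2 / 2))) := by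
  rw [Measure.pi_map_pi (f := fun i y => y + x i) (fun i => by fun_prop)]
  simp_rw [gaussianReal_map_add_const, zero_add]
  refine Measure.pi_eq fun s hs => ?_
  have hint : Integrable (fun v : ι → ℝ => ∏ i, exp (x i * v i - x i ^ 2 / 2))
      (Measure.pi fun i => (gaussianReal 0 1).restrict (s i)) :=
    Integrable.fintype_prod (f := fun i y => exp (x i * y - x i ^ 2 / 2))
      fun i => (integrable_exp_tilt (x i)).restrict
  rw [withDensity_apply _ (.univ_pi hs), Measure.restrict_pi_pi]
  simp_rw [exp_sum]
  rw [← ofReal_integral_eq_lintegral_ofReal hint (ae_of_all _ fun v => by positivity),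
    integral_fintype_prod_eq_prod (fun i y => exp (x i * y - x i ^ 2 / 2)),
    ENNReal.ofReal_prod_of_nonneg fun i _ => integral_nonneg fun y => (exp_pos _).le]
  refine Finset.prod_congr rfl fun i _ => ?_
  rw [gaussianReal_eq_withDensity_exp (x i), withDensity_apply _ (hs i),
    ofReal_integral_eq_lintegral_ofReal (integrable_exp_tilt (x i)).restrict
      (ae_of_all _ fun v => by positivity)]

/-- The Cameron-Martin formula for the standard Gaussian measure. -/
lemma integral_stdGaussianPi_add {g : (ι → ℝ) → ℝ} (hg : Continuous g) (x : ι → ℝ) :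
    ∫ v, g (v + x) ∂stdGaussianPi ι =
      exp (-(∑ i, x i ^ 2) / 2) * ∫ v, g v * exp (∑ i, x i * v i) ∂stdGaussianPi ι := by
  have h1 : ∫ v, g (v + x) ∂stdGaussianPi ι =
      ∫ v, g v ∂(stdGaussianPi ι).map (fun v i => v i + x i) :=
    (integral_map (by fun_prop) hg.aestronglyMeasurable).symm
  rw [h1, stdGaussianPi_map_add, integral_withDensity_eq_integral_toReal_smul (by fun_prop)
    (ae_of_all _ fun _ => ENNReal.ofReal_lt_top), ← integral_const_mul]
  refine integral_congr_ae (ae_of_all _ fun v => ?_)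
  simp only [smul_eq_mul]
  rw [ENNReal.toReal_ofReal (exp_pos _).le, Finset.sum_sub_distrib, ← Finset.sum_div,
    sub_eq_add_neg, exp_add, neg_div]
  ring

/-- Continuous functions of at most exponential growth. -/
def ExpGrowth (g : (ι → ℝ) → ℝ) : Prop :=
  Continuous g ∧ ∃ C c : ℝ, ∀ v, |g v| ≤ C * exp (c * ∑ i, |v i|)

lemma integrable_exp_mul_sum_abs (c : ℝ) :
    Integrable (fun v : ι → ℝ => exp (c * ∑ i, |v i|)) (stdGaussianPi ι) := by
  simp_rw [Finset.mul_sum, exp_sum]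
  exact Integrable.fintype_prod (f := fun _ y => exp (c * |y|)) fun _ =>
    integrable_exp_mul_abs (integrable_exp_mul_gaussianReal c)
      (integrable_exp_mul_gaussianReal (-c))

namespace ExpGrowth

lemma integrable {g : (ι → ℝ) → ℝ} (hg : ExpGrowth g) : Integrable g (stdGaussianPi ι) := by
  obtain ⟨hc, C, c, h⟩ := hg
  exact ((integrable_exp_mul_sum_abs c).const_mul C).mono' hc.aestronglyMeasurable
    (ae_of_all _ h)

lemma mul {g h : (ι → ℝ) → ℝ} (hg : ExpGrowth g) (hh : ExpGrowth h) :
    ExpGrowth fun v => g v * h v := by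
  obtain ⟨hgc, C, c, hg⟩ := hg
  obtain ⟨hhc, C', c', hh⟩ := hh
  refine ⟨hgc.mul hhc, C * C', c + c', fun v => ?_⟩
  rw [abs_mul, add_mul, exp_add, mul_mul_mul_comm]
  exact mul_le_mul (hg v) (hh v) (abs_nonneg _) ((abs_nonneg _).trans (hg v))

lemma const (a : ℝ) : ExpGrowth fun _ : ι → ℝ => a :=
  ⟨continuous_const, |a|, 0, fun v => by simp⟩

lemma coord (i : ι) : ExpGrowth fun v : ι → ℝ => v i := by
  refine ⟨continuous_apply i, 1, 1, fun v => ?_⟩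
  have h : |v i| ≤ ∑ j, |v j| :=
    Finset.single_le_sum (f := fun j => |v j|) (fun j _ => abs_nonneg _) (Finset.mem_univ i)
  rw [one_mul, one_mul]
  linarith [add_one_le_exp (∑ j, |v j|)]

lemma comp_add {g : (ι → ℝ) → ℝ} (hg : ExpGrowth g) (x : ι → ℝ) :
    ExpGrowth fun v => g (v + x) := by
  obtain ⟨hc, C, c, h⟩ := hg
  have hC : 0 ≤ C := by
    exact nonneg_of_mul_nonneg_left ((abs_nonneg _).trans (h 0)) (exp_pos _)
  refine ⟨by fun_prop, C * exp (|c| * ∑ i, |x i|), |c|, fun v => (h _).trans ?_⟩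
  rw [mul_assoc, ← exp_add, ← mul_add, ← Finset.sum_add_distrib]
  have h0 : 0 ≤ ∑ i, |(v + x) i| := Finset.sum_nonneg fun i _ => abs_nonneg _
  gcongr with i
  · exact le_abs_self c
  · exact (abs_add_le _ _).trans_eq (add_comm _ _)

lemma sum_mul_le (x v : ι → ℝ) : ∑ i, x i * v i ≤ ‖x‖ * ∑ i, |v i| := by
  rw [Finset.mul_sum]
  refine Finset.sum_le_sum fun i _ => (le_abs_self _).trans ?_
  rw [abs_mul]
  exact mul_le_mul_of_nonneg_right (norm_le_pi_norm x i) (abs_nonneg _)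

lemma hermite_two [DecidableEq ι] (j k : ι) :
    ExpGrowth fun v : ι → ℝ => v j * v k - if j = k then 1 else 0 := by
  obtain ⟨hc, C, c, h⟩ := (coord j).mul (coord k)
  have hC : 0 ≤ C := nonneg_of_mul_nonneg_left ((abs_nonneg _).trans (h 0)) (exp_pos _)
  refine ⟨hc.sub continuous_const, C + 1, |c|, fun v => (abs_sub _ _).trans ?_⟩
  have h0 : 0 ≤ ∑ i, |v i| := Finset.sum_nonneg fun i _ => abs_nonneg _
  rw [add_mul, one_mul]
  refine add_le_add ((h v).trans ?_) ?_
  · gcongr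
    exact le_abs_self c
  · refine le_trans ?_ (one_le_exp (mul_nonneg (abs_nonneg c) h0))
    split_ifs <;> simp

lemma exp_linear (x : ι → ℝ) : ExpGrowth fun v => exp (∑ i, x i * v i) := by
  refine ⟨by fun_prop, 1, ‖x‖, fun v => ?_⟩
  rw [abs_of_pos (exp_pos _), one_mul]
  exact exp_le_exp.2 (sum_mul_le x v)

end ExpGrowth

/-- The two-sided Laplace transform of `g` with respect to the standard Gaussian measure. -/
def gaussianLaplace (g : (ι → ℝ) → ℝ) (x : ι → ℝ) : ℝ :=
  ∫ v, g v * exp (∑ i, x i * v i) ∂stdGaussianPi ι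

lemma hasFDerivAt_gaussianLaplace {g : (ι → ℝ) → ℝ} (hg : ExpGrowth g) (x : ι → ℝ) :
    HasFDerivAt (gaussianLaplace g)
      (∑ i, gaussianLaplace (fun v => g v * v i) x •
        (ContinuousLinearMap.proj i : (ι → ℝ) →L[ℝ] ℝ)) x := by
  have hterm (i : ι) : Integrable (fun v => g v * v i * exp (∑ i, x i * v i))
      (stdGaussianPi ι) :=
    ((hg.mul (.coord i)).mul (.exp_linear x)).integrable
  have hd : ∫ v, (∑ i, (g v * v i * exp (∑ i, x i * v i)) •
      (ContinuousLinearMap.proj i : (ι → ℝ) →L[ℝ] ℝ)) ∂stdGaussianPi ι =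
      ∑ i, gaussianLaplace (fun v => g v * v i) x •
        (ContinuousLinearMap.proj i : (ι → ℝ) →L[ℝ] ℝ) := by
    rw [integral_finsetSum _ fun i _ => (hterm i).smul_const _]
    exact Finset.sum_congr rfl fun i _ => integral_smul_const _ _
  rw [← hd]
  obtain ⟨hc, -⟩ := id hg
  have hbound : Integrable (fun v => ∑ i, |g v * v i| * exp ((‖x‖ + 1) * ∑ i, |v i|) *
      ‖(ContinuousLinearMap.proj i : (ι → ℝ) →L[ℝ] ℝ)‖) (stdGaussianPi ι) := by
    refine integrable_finsetSum _ fun i _ => Integrable.mul_const ?_ _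
    have he : ExpGrowth fun v : ι → ℝ => exp ((‖x‖ + 1) * ∑ i, |v i|) :=
      ⟨by fun_prop, 1, ‖x‖ + 1, fun v => by rw [abs_of_pos (exp_pos _), one_mul]⟩
    refine ((hg.mul (.coord i)).mul he).integrable.norm.congr (ae_of_all _ fun v => ?_)
    simp [abs_mul]
  have hmeas : Continuous fun v : ι → ℝ => ∑ i, (g v * v i * exp (∑ i, x i * v i)) •
      (ContinuousLinearMap.proj i : (ι → ℝ) →L[ℝ] ℝ) :=
    continuous_finsetSum _ fun i _ =>
      ((hg.mul (.coord i)).mul (.exp_linear x)).1.smul continuous_const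
  have hle (v y : ι → ℝ) (hy : y ∈ Metric.ball x 1) :
      ‖∑ i, (g v * v i * exp (∑ i, y i * v i)) •
        (ContinuousLinearMap.proj i : (ι → ℝ) →L[ℝ] ℝ)‖ ≤
      ∑ i, |g v * v i| * exp ((‖x‖ + 1) * ∑ i, |v i|) *
        ‖(ContinuousLinearMap.proj i : (ι → ℝ) →L[ℝ] ℝ)‖ := by
    refine (norm_sum_le _ _).trans (Finset.sum_le_sum fun i _ => ?_)
    rw [norm_smul, norm_mul, norm_eq_abs, norm_eq_abs, abs_of_pos (exp_pos _)]
    have hy' : ‖y‖ ≤ ‖x‖ + 1 := by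
      have := norm_le_norm_add_norm_sub' y x
      rw [mem_ball_iff_norm] at hy
      linarith
    have h0 : 0 ≤ ∑ i, |v i| := Finset.sum_nonneg fun i _ => abs_nonneg _
    have h1 := (ExpGrowth.sum_mul_le y v).trans (mul_le_mul_of_nonneg_right hy' h0)
    exact mul_le_mul_of_nonneg_right
      (mul_le_mul_of_nonneg_left (exp_le_exp.2 h1) (abs_nonneg _)) (norm_nonneg _)
  have hderiv (v y : ι → ℝ) : HasFDerivAt (fun y : ι → ℝ => g v * exp (∑ i, y i * v i))
      (∑ i, (g v * v i * exp (∑ i, y i * v i)) •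
        (ContinuousLinearMap.proj i : (ι → ℝ) →L[ℝ] ℝ)) y := by
    have h1 : HasFDerivAt (fun y : ι → ℝ => ∑ i, y i * v i)
        (∑ i, v i • (ContinuousLinearMap.proj i : (ι → ℝ) →L[ℝ] ℝ)) y :=
      HasFDerivAt.fun_sum fun i _ =>
        ((ContinuousLinearMap.proj i : (ι → ℝ) →L[ℝ] ℝ).hasFDerivAt).mul_const (v i)
    refine (h1.exp.const_mul (g v)).congr_fderiv ?_
    simp only [Finset.smul_sum, smul_smul]
    exact Finset.sum_congr rfl fun i _ => by ring_nf
  have hF (y : ι → ℝ) := (hg.mul (.exp_linear y)).1.aestronglyMeasurable (μ := stdGaussianPi ι)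
  exact hasFDerivAt_integral_of_dominated_of_fderiv_le
    (F := fun (y v : ι → ℝ) => g v * exp (∑ i, y i * v i))
    (F' := fun y v => ∑ i, (g v * v i * exp (∑ i, y i * v i)) •
      (ContinuousLinearMap.proj i : (ι → ℝ) →L[ℝ] ℝ))
    (Metric.ball_mem_nhds x one_pos) (.of_forall hF) (hg.mul (.exp_linear x)).integrable
    hmeas.aestronglyMeasurable (ae_of_all _ hle) hbound (ae_of_all _ fun v y _ => hderiv v y)

lemma contDiff_gaussianLaplace {g : (ι → ℝ) → ℝ} (hg : ExpGrowth g) :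
    ContDiff ℝ (⊤ : ℕ∞) (gaussianLaplace g) := by
  refine contDiff_infty.2 fun n => ?_
  induction n generalizing g with
  | zero =>
    exact contDiff_zero.2 <| continuous_iff_continuousAt.2 fun x =>
      (hasFDerivAt_gaussianLaplace hg x).continuousAt
  | succ n ih =>
    refine contDiff_succ_iff_hasFDerivAt.2 ⟨_, ?_, hasFDerivAt_gaussianLaplace hg⟩
    exact ContDiff.sum fun i _ => (ih (hg.mul (.coord i))).smul contDiff_const

/-- The Gaussian average `x ↦ E[g(S + x)]`. -/
def gaussianAverage (g : (ι → ℝ) → ℝ) (x : ι → ℝ) : ℝ :=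
  ∫ v, g (v + x) ∂stdGaussianPi ι

lemma gaussianAverage_eq {g : (ι → ℝ) → ℝ} (hg : Continuous g) :
    gaussianAverage g = fun x => exp (-(∑ i, x i ^ 2) / 2) * gaussianLaplace g x :=
  funext fun x => integral_stdGaussianPi_add hg x

lemma contDiff_gaussianAverage {g : (ι → ℝ) → ℝ} (hg : ExpGrowth g) :
    ContDiff ℝ (⊤ : ℕ∞) (gaussianAverage g) := by
  rw [gaussianAverage_eq hg.1]
  have := contDiff_gaussianLaplace hg
  fun_prop

lemma hasFDerivAt_gaussianAverage {g : (ι → ℝ) → ℝ} (hg : ExpGrowth g) (x : ι → ℝ) :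
    HasFDerivAt (gaussianAverage g)
      (∑ i, (∫ v, g (v + x) * v i ∂stdGaussianPi ι) •
        (ContinuousLinearMap.proj i : (ι → ℝ) →L[ℝ] ℝ)) x := by
  rw [gaussianAverage_eq hg.1]
  have hsq : HasFDerivAt (fun y : ι → ℝ => -(∑ i, y i ^ 2) / 2)
      (∑ i, (-x i) • (ContinuousLinearMap.proj i : (ι → ℝ) →L[ℝ] ℝ)) x := by
    have := (HasFDerivAt.fun_sum (u := Finset.univ) fun (i : ι) _ =>
      ((ContinuousLinearMap.proj i : (ι → ℝ) →L[ℝ] ℝ).hasFDerivAt (x := x)).pow 2).mul_const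
        (-1 / 2 : ℝ)
    refine (this.congr_fderiv ?_).congr_of_eventuallyEq (.of_forall fun y => ?_)
    · rw [Finset.smul_sum]
      refine Finset.sum_congr rfl fun i _ => ?_
      ext y
      simp
      ring
    · simp
      ring
  have h := hsq.exp.mul (hasFDerivAt_gaussianLaplace hg x)
  refine h.congr_fderiv ?_
  simp only [Finset.smul_sum, smul_smul, ← Finset.sum_add_distrib, ← add_smul]
  refine Finset.sum_congr rfl fun i _ => ?_
  congr 1
  have hCM := integral_stdGaussianPi_add (g := fun v => g v * (v i - x i))
    (hg.1.mul (by fun_prop)) x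
  simp only [Pi.add_apply, add_sub_cancel_right] at hCM
  rw [hCM]
  have hsub : ∫ v, g v * (v i - x i) * exp (∑ i, x i * v i) ∂stdGaussianPi ι =
      gaussianLaplace (fun v => g v * v i) x - x i * gaussianLaplace g x := by
    unfold gaussianLaplace
    rw [← integral_const_mul, ← integral_sub ((hg.mul (.coord i)).mul (.exp_linear x)).integrable
      ((hg.mul (.exp_linear x)).integrable.const_mul _)]
    refine integral_congr_ae (ae_of_all _ fun v => ?_)
    ring
  rw [hsub]
  ring
lemma hasFDerivAt_gaussianAverage_mul_coord {g : (ι → ℝ) → ℝ} (hg : ExpGrowth g) (j : ι)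
    (x : ι → ℝ) :
    HasFDerivAt (fun x => ∫ v, g (v + x) * v j ∂stdGaussianPi ι)
      (∑ i, (∫ v, g (v + x) * (v j + x j) * v i ∂stdGaussianPi ι) •
          (ContinuousLinearMap.proj i : (ι → ℝ) →L[ℝ] ℝ) -
        (x j • ∑ i, (∫ v, g (v + x) * v i ∂stdGaussianPi ι) •
            (ContinuousLinearMap.proj i : (ι → ℝ) →L[ℝ] ℝ) +
          gaussianAverage g x • (ContinuousLinearMap.proj j : (ι → ℝ) →L[ℝ] ℝ))) x := by
  have heq : (fun x => ∫ v, g (v + x) * v j ∂stdGaussianPi ι) =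
      fun x => gaussianAverage (fun v => g v * v j) x - x j * gaussianAverage g x := by
    ext y
    unfold gaussianAverage
    rw [← integral_const_mul, ← integral_sub ((hg.mul (.coord j)).comp_add y).integrable
      ((hg.comp_add y).integrable.const_mul _)]
    refine integral_congr_ae (ae_of_all _ fun v => ?_)
    simp only [Pi.add_apply]
    ring
  rw [heq]
  exact (hasFDerivAt_gaussianAverage (hg.mul (.coord j)) x).fun_sub
    (((ContinuousLinearMap.proj j : (ι → ℝ) →L[ℝ] ℝ).hasFDerivAt (x := x)).mul
      (hasFDerivAt_gaussianAverage hg x))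

lemma fderiv_comp_const_smul_apply {f : (ι → ℝ) → ℝ} {u : ι → ℝ} {c : ℝ} (e : ι → ℝ)
    (hf : DifferentiableAt ℝ f (c • u)) :
    fderiv ℝ (fun u => f (c • u)) u e = c * fderiv ℝ f (c • u) e := by
  have h := hf.hasFDerivAt.comp u ((hasFDerivAt_id u).const_smul c)
  rw [show (fun u => f (c • u)) = f ∘ HSMul.hSMul c from rfl, h.fderiv]
  simp

section Coordinates

variable [DecidableEq ι]

lemma fderiv_gaussianAverage_single {g : (ι → ℝ) → ℝ} (hg : ExpGrowth g) (x : ι → ℝ) (j : ι) :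
    fderiv ℝ (gaussianAverage g) x (Pi.single j 1) = ∫ v, g (v + x) * v j ∂stdGaussianPi ι := by
  rw [(hasFDerivAt_gaussianAverage hg x).fderiv]
  simp [Pi.single_apply]

lemma fderiv_gaussianAverage_mul_coord_single {g : (ι → ℝ) → ℝ} (hg : ExpGrowth g) (x : ι → ℝ)
    (j k : ι) :
    fderiv ℝ (fun x => ∫ v, g (v + x) * v k ∂stdGaussianPi ι) x (Pi.single j 1) =
      ∫ v, g (v + x) * (v j * v k - if j = k then 1 else 0) ∂stdGaussianPi ι := by
  have hgx := hg.comp_add x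
  have h1 := ((hgx.mul (.coord k)).mul (.coord j)).integrable
  have h2 := (hgx.mul (.coord j)).integrable
  have h3 : ∫ v, g (v + x) * (v k + x k) * v j ∂stdGaussianPi ι =
      ∫ v, g (v + x) * v k * v j ∂stdGaussianPi ι +
        x k * ∫ v, g (v + x) * v j ∂stdGaussianPi ι := by
    rw [← integral_const_mul, ← integral_add h1 (h2.const_mul _)]
    exact integral_congr_ae (ae_of_all _ fun v => by ring)
  have h4 : ∫ v, g (v + x) * (v j * v k - if j = k then 1 else 0) ∂stdGaussianPi ι =
      ∫ v, g (v + x) * v k * v j ∂stdGaussianPi ι -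
        (if j = k then 1 else 0) * ∫ v, g (v + x) ∂stdGaussianPi ι := by
    rw [← integral_const_mul, ← integral_sub h1 (hgx.integrable.const_mul _)]
    exact integral_congr_ae (ae_of_all _ fun v => by ring)
  rw [(hasFDerivAt_gaussianAverage_mul_coord hg k x).fderiv, h4]
  simp [Pi.single_apply, h3, gaussianAverage, eq_comm (a := k)]
  ring

end Coordinates

lemma integral_sq_gaussianReal : ∫ x, x ^ 2 ∂gaussianReal 0 1 = 1 := by
  have h := variance_fun_id_gaussianReal (μ := 0) (v := 1)
  rw [variance_of_integral_eq_zero (by fun_prop) integral_id_gaussianReal] at h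
  simpa using h

lemma integrable_sq_gaussianReal : Integrable (fun x => x ^ 2) (gaussianReal 0 1) :=
  (memLp_id_gaussianReal 2).integrable_sq

lemma integral_posPart_one_sub_sq_gaussianReal :
    ∫ x, max (1 - x ^ 2) 0 ∂gaussianReal 0 1 = 2 * gaussianPDFReal 0 1 1 := by
  have hind : (fun x => gaussianPDFReal 0 1 x • max (1 - x ^ 2) 0) =
      (Set.Ioc (-1 : ℝ) 1).indicator fun x => gaussianPDFReal 0 1 x * (1 - x ^ 2) := by
    ext x
    by_cases hx : x ∈ Set.Ioc (-1 : ℝ) 1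
    · rw [Set.indicator_of_mem hx, max_eq_left (by nlinarith [hx.1, hx.2]), smul_eq_mul]
    · rw [Set.indicator_of_notMem hx, max_eq_right, smul_zero]
      by_contra! h
      exact hx ⟨by nlinarith, by nlinarith⟩
  have hderiv (x : ℝ) : HasDerivAt (fun x => x * gaussianPDFReal 0 1 x)
      (gaussianPDFReal 0 1 x * (1 - x ^ 2)) x := by
    have h1 : HasDerivAt (fun x : ℝ => -(x - 0) ^ 2 / (2 * (1 : NNReal))) (-x) x := by
      have := ((hasDerivAt_id x).pow 2).mul_const (-1 / 2 : ℝ)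
      refine (this.congr_deriv ?_).congr_of_eventuallyEq (.of_forall fun y => ?_)
      · simp
        ring
      · simp
        ring
    have h2 := (hasDerivAt_id x).mul (h1.exp.const_mul (√(2 * π * (1 : NNReal)))⁻¹)
    refine h2.congr_deriv ?_
    simp only [gaussianPDFReal, id]
    ring
  have hcont : Continuous fun x => gaussianPDFReal 0 1 x * (1 - x ^ 2) := by
    unfold gaussianPDFReal
    fun_prop
  rw [integral_gaussianReal_eq_integral_smul one_ne_zero, hind,
    integral_indicator measurableSet_Ioc, ← intervalIntegral.integral_of_le (by norm_num),
    intervalIntegral.integral_eq_sub_of_hasDerivAt (fun x _ => hderiv x)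
      (hcont.intervalIntegrable _ _)]
  simp [gaussianPDFReal]
  ring

lemma gaussianPDFReal_zero_one_one_le : gaussianPDFReal 0 1 1 ≤ 1 / 4 := by
  have h1 : (4 : ℝ) ≤ √(2 * π) * exp (1 / 2) := by
    refine abs_le_of_sq_le_sq' ?_ (by positivity) |>.2
    rw [mul_pow, sq_sqrt (by positivity), ← exp_nat_mul]
    norm_num
    nlinarith [pi_gt_d2, exp_one_gt_d9]
  have h2 : gaussianPDFReal 0 1 1 = (√(2 * π) * exp (1 / 2))⁻¹ := by
    rw [mul_inv, ← exp_neg, gaussianPDFReal]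
    norm_num
  rw [h2, one_div 4]
  exact inv_anti₀ (by norm_num) h1

lemma integral_abs_sq_sub_one_gaussianReal_le :
    ∫ x, |x ^ 2 - 1| ∂gaussianReal 0 1 ≤ 1 := by
  have hi : Integrable (fun x : ℝ => x ^ 2 - 1) (gaussianReal 0 1) :=
    integrable_sq_gaussianReal.sub (integrable_const 1)
  have hp : Integrable (fun x : ℝ => max (1 - x ^ 2) 0) (gaussianReal 0 1) :=
    ((integrable_const 1).sub integrable_sq_gaussianReal).pos_part
  have heq (x : ℝ) : |x ^ 2 - 1| = (x ^ 2 - 1) + 2 * max (1 - x ^ 2) 0 := by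
    rcases le_total (x ^ 2) 1 with h | h
    · rw [abs_of_nonpos (by linarith), max_eq_left (by linarith)]
      ring
    · rw [abs_of_nonneg (by linarith), max_eq_right (by linarith)]
      ring
  simp_rw [heq]
  rw [integral_add hi (hp.const_mul 2), integral_const_mul,
    integral_posPart_one_sub_sq_gaussianReal,
    integral_sub integrable_sq_gaussianReal (integrable_const 1), integral_sq_gaussianReal]
  have := gaussianPDFReal_zero_one_one_le
  simp
  linarith

lemma integrable_sq_stdGaussianPi (i : ι) :
    Integrable (fun v : ι → ℝ => v i ^ 2) (stdGaussianPi ι) :=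
  integrable_comp_eval (μ := fun _ : ι => gaussianReal 0 1) (i := i)
    (f := fun y : ℝ => y ^ 2) integrable_sq_gaussianReal

lemma integral_sq_stdGaussianPi (i : ι) : ∫ v : ι → ℝ, v i ^ 2 ∂stdGaussianPi ι = 1 :=
  (integral_comp_eval (μ := fun _ : ι => gaussianReal 0 1) (i := i)
    (f := fun y : ℝ => y ^ 2) (by fun_prop)).trans integral_sq_gaussianReal

lemma integral_abs_coord_le (i : ι) : ∫ v : ι → ℝ, |v i| ∂stdGaussianPi ι ≤ 1 := by
  have h := integral_mono (ExpGrowth.coord i).integrable.abs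
    (((integrable_sq_stdGaussianPi i).add (integrable_const (1 : ℝ))).div_const 2) fun v => by
      change |v i| ≤ (v i ^ 2 + 1) / 2
      nlinarith [sq_abs (v i), sq_nonneg (|v i| - 1)]
  refine h.trans_eq ?_
  simp only [Pi.add_apply]
  rw [integral_div, integral_add (integrable_sq_stdGaussianPi i) (integrable_const _),
    integral_sq_stdGaussianPi]
  simp

lemma integral_abs_hermite_two_le [DecidableEq ι] (j k : ι) :
    ∫ v : ι → ℝ, |v j * v k - if j = k then 1 else 0| ∂stdGaussianPi ι ≤ 1 := by
  by_cases hjk : j = k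
  · subst hjk
    simp only [if_true, ← sq]
    exact (integral_comp_eval (μ := fun _ : ι => gaussianReal 0 1) (i := j)
    (f := fun y : ℝ => |y ^ 2 - 1|) (by fun_prop)).trans_le
      integral_abs_sq_sub_one_gaussianReal_le
  · simp only [if_neg hjk, sub_zero]
    have h := integral_mono ((ExpGrowth.coord j).mul (.coord k)).integrable.abs
      (((integrable_sq_stdGaussianPi j).add (integrable_sq_stdGaussianPi k)).div_const 2)
      fun v => by
        change |v j * v k| ≤ (v j ^ 2 + v k ^ 2) / 2
        rw [abs_mul]
        nlinarith [sq_abs (v j), sq_abs (v k), sq_nonneg (|v j| - |v k|)]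
    refine h.trans_eq ?_
    simp only [Pi.add_apply]
    rw [integral_div, integral_add (integrable_sq_stdGaussianPi j)
      (integrable_sq_stdGaussianPi k), integral_sq_stdGaussianPi, integral_sq_stdGaussianPi]
    norm_num

lemma LipschitzEuclid.abs_add_smul_single_sub_le [DecidableEq ι] {ζ : (ι → ℝ) → ℝ}
    (hζ : LipschitzEuclid ζ) (w : ι → ℝ) (t : ℝ) (i : ι) :
    |ζ (w + t • Pi.single i 1) - ζ w| ≤ |t| := by
  refine (hζ _ _).trans_eq ?_
  simp [Pi.single_apply, sqrt_sq_eq_abs]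

lemma LipschitzEuclid.continuous {ζ : (ι → ℝ) → ℝ} (hζ : LipschitzEuclid ζ) : Continuous ζ := by
  refine continuous_iff_continuousAt.2 fun x => ?_
  refine tendsto_iff_norm_sub_tendsto_zero.2 ?_
  refine squeeze_zero (fun _ => norm_nonneg _) (fun y => hζ y x) ?_
  have h : Continuous fun y : ι → ℝ => √(∑ i, (y i - x i) ^ 2) := by fun_prop
  simpa using h.tendsto x

lemma LipschitzEuclid.expGrowth_comp_smul {ζ : (ι → ℝ) → ℝ} (hζ : LipschitzEuclid ζ) (ε : ℝ) :
    ExpGrowth fun v => ζ (ε • v) := by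
  refine ⟨hζ.continuous.comp (continuous_const_smul ε), |ζ 0| + |ε|, 1, fun v => ?_⟩
  have h0 : 0 ≤ ∑ i, |v i| := Finset.sum_nonneg fun i _ => abs_nonneg _
  have h1 : √(∑ i, ((ε • v) i - (0 : ι → ℝ) i) ^ 2) ≤ |ε| * ∑ i, |v i| := by
    refine sqrt_le_iff.2 ⟨by positivity, ?_⟩
    simp only [Pi.smul_apply, smul_eq_mul, Pi.zero_apply, sub_zero, mul_pow, ← Finset.mul_sum,
      sq_abs]
    gcongr
    simpa using Finset.sum_sq_le_sq_sum_of_nonneg (s := Finset.univ) (f := fun i => |v i|)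
      fun i _ => abs_nonneg _
  have h2 := hζ (ε • v) 0
  have h3 := abs_sub_abs_le_abs_sub (ζ (ε • v)) (ζ 0)
  have h4 := add_one_le_exp (∑ i, |v i|)
  rw [one_mul]
  nlinarith [abs_nonneg (ζ 0), abs_nonneg ε]

/-- If `ζ` is Lipschitz, then a weighted Gaussian smoothing of `ζ` has directional derivatives
bounded by the `L¹` norm of the weight. -/
lemma LipschitzEuclid.abs_fderiv_integral_mul_le [DecidableEq ι] {ζ : (ι → ℝ) → ℝ}
    (hζ : LipschitzEuclid ζ) {ε : ℝ} (hε : ε ≠ 0) {q : (ι → ℝ) → ℝ} (hq : ExpGrowth q) {C : ℝ}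
    (hC : ∫ v, |q v| ∂stdGaussianPi ι ≤ C) {c : ℝ} (hc : 0 ≤ c) {F : (ι → ℝ) → ℝ}
    (hF : F = fun u => c * ∫ v, ζ (ε • (v + ε⁻¹ • u)) * q v ∂stdGaussianPi ι)
    {u : ι → ℝ} (hd : DifferentiableAt ℝ F u) (i : ι) :
    |fderiv ℝ F u (Pi.single i 1)| ≤ c * C := by
  have hC0 : 0 ≤ C := (integral_nonneg fun v => abs_nonneg (q v)).trans hC
  have hint (w : ι → ℝ) : Integrable (fun v => ζ (ε • (v + w)) * q v) (stdGaussianPi ι) :=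
    (((hζ.expGrowth_comp_smul ε).comp_add w).mul hq).integrable
  refine HasDerivAt.le_of_lip' (hd.hasFDerivAt.hasLineDerivAt (Pi.single i 1)) (mul_nonneg hc hC0)
    (.of_forall fun t => ?_)
  rw [zero_smul, add_zero, sub_zero, hF, norm_eq_abs, norm_eq_abs, ← mul_sub, abs_mul,
    abs_of_nonneg hc, mul_assoc, ← integral_sub (hint _) (hint _)]
  refine mul_le_mul_of_nonneg_left ?_ hc
  have hpt (v : ι → ℝ) : ‖ζ (ε • (v + ε⁻¹ • (u + t • Pi.single i 1))) * q v -
      ζ (ε • (v + ε⁻¹ • u)) * q v‖ ≤ |q v| * |t| := by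
    rw [← sub_mul, norm_eq_abs, abs_mul, mul_comm]
    refine mul_le_mul_of_nonneg_left ?_ (abs_nonneg _)
    have : ε • (v + ε⁻¹ • (u + t • Pi.single i 1)) =
        ε • (v + ε⁻¹ • u) + t • (Pi.single i 1 : ι → ℝ) := by
      simp only [smul_add, smul_smul, mul_inv_cancel_left₀ hε, mul_inv_cancel₀ hε]
      module
    rw [this]
    exact hζ.abs_add_smul_single_sub_le _ t i
  refine (norm_integral_le_of_norm_le (hq.integrable.abs.mul_const _) (ae_of_all _ hpt)).trans ?_
  rw [integral_mul_const]
  exact mul_le_mul_of_nonneg_right hC (abs_nonneg _)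

section PartialDerivatives

variable [DecidableEq ι] {f : (ι → ℝ) → ℝ}

lemma pd1_eq_fderiv (u : ι → ℝ) (i : ι) : pd1 f u i = fderiv ℝ f u (Pi.single i 1) :=
  iteratedFDeriv_one_apply _

lemma pd2_eq_fderiv (hf : ContDiff ℝ (⊤ : ℕ∞) f) (u : ι → ℝ) (i j : ι) :
    pd2 f u i j = fderiv ℝ (fun u => fderiv ℝ f u (Pi.single j 1)) u (Pi.single i 1) := by
  have hd : DifferentiableAt ℝ (fderiv ℝ f) u :=
    (hf.fderiv_right (m := 1) (by norm_cast)).differentiable one_ne_zero u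
  rw [pd2, iteratedFDeriv_two_apply, fderiv_clm_apply hd (differentiableAt_const _)]
  simp

lemma pd3_eq_fderiv (hf : ContDiff ℝ (⊤ : ℕ∞) f) (u : ι → ℝ) (i j k : ι) :
    pd3 f u i j k = fderiv ℝ (fun u => pd2 f u j k) u (Pi.single i 1) := by
  have hd : DifferentiableAt ℝ (iteratedFDeriv ℝ 2 f) u :=
    hf.differentiable_iteratedFDeriv (by norm_cast) u
  rw [pd3, hd.iteratedFDeriv_succ_apply_left']
  rfl

end PartialDerivatives

end GaussianSmoothing

/-- **Gaussian regularization.** If `ζ` is `1`-Lipschitz (w.r.t. the Euclidean norm) and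
`ζ_ε(u) = E[ζ(u + εS)]` for a standard Gaussian vector `S`, then `ζ_ε` is infinitely
differentiable and `|∂_i ζ_ε| ≤ 1`, `|∂_{i,j} ζ_ε| ≤ 1/ε`, `|∂_{i,j,k} ζ_ε| ≤ 1/ε²`. -/
theorem stmt15 (D : ℕ) (ζ : (Fin D → ℝ) → ℝ) (hζ : LipschitzEuclid ζ) (ε : ℝ) (hε : 0 < ε)
    (ζε : (Fin D → ℝ) → ℝ)
    (hdef : ζε = fun u => ∫ v, ζ (fun i => u i + ε * v i)
      ∂(Measure.pi fun _ : Fin D => gaussianReal 0 1)) :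
    ContDiff ℝ (⊤ : ℕ∞) ζε ∧ (∀ u i, |pd1 ζε u i| ≤ 1) ∧
      (∀ u i j, |pd2 ζε u i j| ≤ 1 / ε) ∧ (∀ u i j k, |pd3 ζε u i j k| ≤ 1 / ε ^ 2) := by
  have hg := hζ.expGrowth_comp_smul ε
  set g : (Fin D → ℝ) → ℝ := fun v => ζ (ε • v) with hgdef
  have hε' : (0 : ℝ) ≤ ε⁻¹ := (inv_pos.2 hε).le
  have havg : ζε = fun u => gaussianAverage g (ε⁻¹ • u) := by
    rw [hdef]
    ext u
    refine integral_congr_ae (ae_of_all _ fun v => congrArg ζ ?_)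
    ext i
    simp
    field_simp
    ring
  have hsmooth : ContDiff ℝ (⊤ : ℕ∞) ζε := by
    rw [havg]
    exact (contDiff_gaussianAverage hg).comp (contDiff_const_smul _)
  have hfirst (j : Fin D) : (fun u => fderiv ℝ ζε u (Pi.single j 1)) =
      fun u => ε⁻¹ * ∫ v, g (v + ε⁻¹ • u) * v j ∂stdGaussianPi (Fin D) := by
    ext u
    rw [havg, fderiv_comp_const_smul_apply _ (hasFDerivAt_gaussianAverage hg _).differentiableAt,
      fderiv_gaussianAverage_single hg]
  have hsecond (j k : Fin D) : (fun u => pd2 ζε u j k) = fun u => ε⁻¹ ^ 2 *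
      ∫ v, g (v + ε⁻¹ • u) * (v j * v k - if j = k then 1 else 0) ∂stdGaussianPi (Fin D) := by
    ext u
    have hd := (hasFDerivAt_gaussianAverage_mul_coord hg k (ε⁻¹ • u)).differentiableAt
    have hd' : DifferentiableAt ℝ
        (fun u => ∫ v, g (v + ε⁻¹ • u) * v k ∂stdGaussianPi (Fin D)) u :=
      hd.comp u (differentiableAt_id.const_smul ε⁻¹)
    rw [pd2_eq_fderiv hsmooth, hfirst, fderiv_const_mul hd', _root_.smul_apply,
      smul_eq_mul, fderiv_comp_const_smul_apply
        (f := fun x => ∫ v, g (v + x) * v k ∂stdGaussianPi (Fin D)) _ hd,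
      fderiv_gaussianAverage_mul_coord_single hg, ← mul_assoc, sq]
  refine ⟨hsmooth, fun u i => ?_, fun u i j => ?_, fun u i j k => ?_⟩
  · rw [pd1_eq_fderiv]
    refine (hζ.abs_fderiv_integral_mul_le hε.ne' (.const 1) (C := 1) (by simp) zero_le_one ?_
      (hsmooth.differentiable (by simp) u) i).trans_eq (one_mul 1)
    rw [havg]
    simp [gaussianAverage, hgdef]
  · rw [pd2_eq_fderiv hsmooth]
    refine (hζ.abs_fderiv_integral_mul_le hε.ne' (.coord j) (integral_abs_coord_le j) hε'
      (hfirst j) ?_ i).trans_eq (by simp)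
    exact ((hsmooth.fderiv_right (m := 1) (by norm_cast)).clm_apply contDiff_const).differentiable
      one_ne_zero u
  · rw [pd3_eq_fderiv hsmooth]
    refine (hζ.abs_fderiv_integral_mul_le hε.ne' (.hermite_two j k)
      (integral_abs_hermite_two_le j k) (by positivity) (hsecond j k) ?_ i).trans_eq (by simp)
    have hd : DifferentiableAt ℝ (iteratedFDeriv ℝ 2 ζε) u :=
      hsmooth.differentiable_iteratedFDeriv (by norm_cast) u
    exact hd.continuousMultilinear_apply_const _

end
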